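/- arXiv:1908.00063 — 4 statements merged into one kernel-verified Lean document; each statement's English description precedes it below -/
import Mathlib

section
/- Let M ∈ ℝ^{n×n} be an ultra matrix and define D_{ij} = 2M_{ij} − M_{ii} − M_{jj}. Then D is a pseudometric on {1,…,n}: D_{ii} = 0, D_{ij} ≥ 0, D_{ij} = D_{ji}, and D_{ij} ≤ D_{ik} + D_{kj} for all i, j, k. -/
/-- A matrix is *valid* if it is symmetric and each diagonal entry is a
minimum of its row. -/
def IsValid {n : ℕ} (M : Fin n → Fin n → ℝ) : Prop :=
  (∀ i j, M i j = M j i) ∧ (∀ i j, M i i ≤ M i j)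

/-- A matrix is *ultra* if it is valid and satisfies the ultrametric-type
inequality `M i j ≤ max (M i k) (M k j)`. -/
def IsUltra {n : ℕ} (M : Fin n → Fin n → ℝ) : Prop :=
  IsValid M ∧ ∀ i j k, M i j ≤ max (M i k) (M k j)

/-- The value of a path `v 0, …, v k`: the maximum of the edge weights
`M (v l) (v (l+1))` together with the diagonal entries at the two endpoints. -/
def pathVal {n : ℕ} (M : Fin n → Fin n → ℝ) {k : ℕ} (v : Fin (k + 1) → Fin n) : ℝ :=
  Finset.univ.fold max
    (max (M (v 0) (v 0)) (M (v (Fin.last k)) (v (Fin.last k))))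
    (fun l : Fin k => M (v l.castSucc) (v l.succ))

/-- The ultra-fication `Ũ(M)`: entry `(i,j)` is the minimax path value
over all finite paths from `i` to `j` in the complete graph with edge
weights `M u v` (the diagonal entries `M i i`, `M j j` always participate
in the max). -/
noncomputable def ultraFy {n : ℕ} (M : Fin n → Fin n → ℝ) : Fin n → Fin n → ℝ :=
  fun i j => sInf { x | ∃ (k : ℕ) (v : Fin (k + 1) → Fin n),
    v 0 = i ∧ v (Fin.last k) = j ∧ x = pathVal M v }

/-- The entrywise sup distance `‖A - B‖_∞`. -/
noncomputable def supDist {n : ℕ} (A B : Fin n → Fin n → ℝ) : ℝ :=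
  sSup { x | ∃ i j, x = |A i j - B i j| }

/-- For an ultra matrix `M`, the function `D i j = 2 M i j - M i i - M j j`
is a pseudometric on `{1,…,n}`. -/
theorem ultra_induces_pseudometric {n : ℕ} (hn : 1 ≤ n)
    (M : Fin n → Fin n → ℝ) (hM : IsUltra M)
    (D : Fin n → Fin n → ℝ)
    (hD : ∀ i j, D i j = 2 * M i j - M i i - M j j) :
    (∀ i, D i i = 0) ∧
    (∀ i j, 0 ≤ D i j) ∧
    (∀ i j, D i j = D j i) ∧
    (∀ i j k, D i j ≤ D i k + D k j) := by
  obtain ⟨⟨hsymm, hdiag⟩, hultra⟩ := hM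
  refine ⟨fun i => ?_, fun i j => ?_, fun i j => ?_, fun i j k => ?_⟩
  · rw [hD]; ring
  · rw [hD]
    linarith [hdiag i j, hdiag j i, hsymm i j]
  · rw [hD, hD, hsymm i j]; ring
  · rw [hD, hD, hD]
    rcases le_max_iff.mp (hultra i j k) with h | h
    · linarith [hdiag k j]
    · linarith [hdiag k i, hsymm i k]
end

section
/- The set of ultra matrices in ℝ^{n×n} is a closed subset of the space of all real n×n matrices with the entrywise sup-norm topology; consequently, the set of ultra matrices equipped with the sup distance ‖·−·‖_∞ is a complete metric space. (Equivalently: the space of n-labeled merge trees with the labeled interleaving distance is complete.) -/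
theorem isClosed_setOf_isUltra (n : ℕ) :
    IsClosed {M : Fin n → Fin n → ℝ | IsUltra M} := by
  simp only [IsUltra, IsValid, Set.ofPred_and, Set.ofPred_forall]
  refine ((isClosed_iInter fun i => isClosed_iInter fun j => isClosed_eq ?_ ?_).inter
    (isClosed_iInter fun i => isClosed_iInter fun j => isClosed_le ?_ ?_)).inter
    (isClosed_iInter fun i => isClosed_iInter fun j => isClosed_iInter fun k =>
      isClosed_le ?_ ?_) <;> fun_prop

/-- The set of ultra matrices is closed in `Fin n → Fin n → ℝ` (whose
product metric is exactly the entrywise sup distance), and hence is a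
complete metric space. -/
theorem ultraMatrices_isClosed_isComplete {n : ℕ} (hn : 1 ≤ n) :
    IsClosed {M : Fin n → Fin n → ℝ | IsUltra M} ∧
    IsComplete {M : Fin n → Fin n → ℝ | IsUltra M} :=
  ⟨isClosed_setOf_isUltra n, (isClosed_setOf_isUltra n).isComplete⟩
end

section
/- For all valid matrices M, M' ∈ ℝ^{n×n}, one has ‖Ũ(M) − Ũ(M')‖_∞ ≤ ‖M − M'‖_∞; that is, the ultra-fication map Ũ is 1-Lipschitz with respect to the entrywise sup distance. (Equivalently: the labeled interleaving distance between the labeled merge trees of two valid matrices is at most the sup distance between the matrices.) -/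
theorem pathVal_le_iff {n : ℕ} (M : Fin n → Fin n → ℝ) {k : ℕ} (v : Fin (k + 1) → Fin n)
    (c : ℝ) :
    pathVal M v ≤ c ↔ (M (v 0) (v 0) ≤ c ∧ M (v (Fin.last k)) (v (Fin.last k)) ≤ c) ∧
      ∀ l : Fin k, M (v l.castSucc) (v l.succ) ≤ c := by
  simp [pathVal, Finset.fold_max_le]

/-- Path values increase by at most `d` when every entry of the matrix increases by at most `d`. -/
theorem pathVal_le_add {n : ℕ} {A B : Fin n → Fin n → ℝ} {d : ℝ}
    (h : ∀ i j, A i j ≤ B i j + d) {k : ℕ} (v : Fin (k + 1) → Fin n) :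
    pathVal A v ≤ pathVal B v + d := by
  obtain ⟨⟨h₀, h₁⟩, hl⟩ := (pathVal_le_iff B v _).1 le_rfl
  exact (pathVal_le_iff A v _).2
    ⟨⟨(h _ _).trans (by gcongr), (h _ _).trans (by gcongr)⟩,
      fun l => (h _ _).trans (by gcongr; exact hl l)⟩

theorem ultraFy_le_pathVal {n : ℕ} (M : Fin n → Fin n → ℝ) {k : ℕ}
    (v : Fin (k + 1) → Fin n) :
    ultraFy M (v 0) (v (Fin.last k)) ≤ pathVal M v := by
  refine csInf_le ⟨M (v 0) (v 0), ?_⟩ ⟨k, v, rfl, rfl, rfl⟩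
  rintro _ ⟨m, w, hw, -, rfl⟩
  rw [← hw]
  exact ((pathVal_le_iff M w _).1 le_rfl).1.1

theorem ultraFy_le_add {n : ℕ} {A B : Fin n → Fin n → ℝ} {d : ℝ}
    (h : ∀ i j, A i j ≤ B i j + d) (i j : Fin n) :
    ultraFy A i j ≤ ultraFy B i j + d := by
  rw [← sub_le_iff_le_add]
  refine le_csInf ⟨_, 1, ![i, j], rfl, rfl, rfl⟩ ?_
  rintro _ ⟨k, v, rfl, rfl, rfl⟩
  rw [sub_le_iff_le_add]
  exact (ultraFy_le_pathVal A v).trans (pathVal_le_add h v)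

theorem abs_sub_le_supDist {n : ℕ} (A B : Fin n → Fin n → ℝ) (i j : Fin n) :
    |A i j - B i j| ≤ supDist A B := by
  refine le_csSup (Set.Finite.bddAbove ?_) ⟨i, j, rfl⟩
  refine (Set.finite_range fun p : Fin n × Fin n => |A p.1 p.2 - B p.1 p.2|).subset ?_
  rintro _ ⟨a, b, rfl⟩
  exact ⟨(a, b), rfl⟩

/-- The ultra-fication is 1-Lipschitz for the entrywise sup distance on
valid matrices. -/
theorem ultraFy_lipschitz {n : ℕ} (hn : 1 ≤ n)
    (M M' : Fin n → Fin n → ℝ) (hM : IsValid M) (hM' : IsValid M') :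
    supDist (ultraFy M) (ultraFy M') ≤ supDist M M' := by
  refine csSup_le ⟨_, ⟨0, hn⟩, ⟨0, hn⟩, rfl⟩ ?_
  rintro _ ⟨i, j, rfl⟩
  have h a b := abs_sub_le_iff.1 (abs_sub_le_supDist M M' a b)
  exact abs_sub_le_iff.2
    ⟨sub_le_iff_le_add'.2 (ultraFy_le_add (fun a b => sub_le_iff_le_add'.1 (h a b).1) i j),
      sub_le_iff_le_add'.2 (ultraFy_le_add (fun a b => sub_le_iff_le_add'.1 (h a b).2) i j)⟩
end

section
/- For any two ultra matrices M, M' ∈ ℝ^{n×n}, there exists an ultra matrix N (namely N = Ũ((M + M')/2)) such that ‖M − N‖_∞ = ‖N − M'‖_∞ = ‖M − M'‖_∞ / 2. Hence the space of ultra matrices with the sup distance (equivalently, the space of labeled merge trees with the labeled interleaving distance) admits midpoints, and the labeled interleaving distance is strictly intrinsic. -/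
theorem pathVal_lt_iff {n : ℕ} (M : Fin n → Fin n → ℝ) {k : ℕ} (v : Fin (k + 1) → Fin n)
    (c : ℝ) :
    pathVal M v < c ↔ M (v 0) (v 0) < c ∧ M (v (Fin.last k)) (v (Fin.last k)) < c ∧
      ∀ l : Fin k, M (v l.castSucc) (v l.succ) < c := by
  simp [pathVal, Finset.fold_max_lt, and_assoc]

theorem reflTransGen_iff_exists_fin_path {α : Type*} {r : α → α → Prop} {a b : α} :
    Relation.ReflTransGen r a b ↔ ∃ (k : ℕ) (v : Fin (k + 1) → α),
      v 0 = a ∧ v (Fin.last k) = b ∧ ∀ l : Fin k, r (v l.castSucc) (v l.succ) := by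
  constructor
  · intro h
    induction h using Relation.ReflTransGen.head_induction_on with
    | refl => exact ⟨0, fun _ => b, rfl, rfl, fun l => l.elim0⟩
    | @head x y hxy _ ih =>
      obtain ⟨k, v, h0, hk, hv⟩ := ih
      refine ⟨k + 1, Fin.cons x v, rfl, ?_, fun l => ?_⟩
      · rw [← Fin.succ_last, Fin.cons_succ, hk]
      · cases l using Fin.cases with
        | zero => simpa [h0] using hxy
        | succ l => simpa [← Fin.succ_castSucc] using hv l
  · rintro ⟨k, v, rfl, rfl, hv⟩
    have h (l : Fin (k + 1)) : Relation.ReflTransGen r (v 0) (v l) := by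
      induction l using Fin.induction with
      | zero => exact .refl
      | succ l ih => exact ih.tail (hv l)
    exact h _

/-- The strict sublevel sets of the ultra-fication are described by reachability along edges of
weight less than `c`. -/
theorem ultraFy_lt_iff {n : ℕ} (M : Fin n → Fin n → ℝ) (i j : Fin n) (c : ℝ) :
    ultraFy M i j < c ↔
      M i i < c ∧ M j j < c ∧ Relation.ReflTransGen (fun u v => M u v < c) i j := by
  have hbdd : BddBelow { x | ∃ (k : ℕ) (v : Fin (k + 1) → Fin n),
      v 0 = i ∧ v (Fin.last k) = j ∧ x = pathVal M v } := by
    refine ⟨M i i, ?_⟩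
    rintro x ⟨k, v, rfl, rfl, rfl⟩
    exact le_of_forall_gt fun c hc => ((pathVal_lt_iff M v c).1 hc).1
  have hne : { x | ∃ (k : ℕ) (v : Fin (k + 1) → Fin n),
      v 0 = i ∧ v (Fin.last k) = j ∧ x = pathVal M v }.Nonempty :=
    ⟨_, 1, ![i, j], rfl, rfl, rfl⟩
  rw [ultraFy, csInf_lt_iff hbdd hne, reflTransGen_iff_exists_fin_path]
  constructor
  · rintro ⟨x, ⟨k, v, rfl, rfl, rfl⟩, hx⟩
    obtain ⟨h0, hk, hv⟩ := (pathVal_lt_iff M v c).1 hx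
    exact ⟨h0, hk, k, v, rfl, rfl, hv⟩
  · rintro ⟨hi, hj, k, v, rfl, rfl, hv⟩
    exact ⟨_, ⟨k, v, rfl, rfl, rfl⟩, (pathVal_lt_iff M v c).2 ⟨hi, hj, hv⟩⟩

theorem isUltra_ultraFy {n : ℕ} {M : Fin n → Fin n → ℝ} (hM : ∀ i j, M i j = M j i) :
    IsUltra (ultraFy M) := by
  have hle (i j : Fin n) : ultraFy M i j ≤ ultraFy M j i := by
    refine le_of_forall_gt fun c hc => ?_
    obtain ⟨hj, hi, h⟩ := (ultraFy_lt_iff M j i c).1 hc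
    refine (ultraFy_lt_iff M i j c).2 ⟨hi, hj, ?_⟩
    have : Std.Symm fun u v => M u v < c := ⟨fun u v huv => by rwa [hM v u]⟩
    exact symm h
  refine ⟨⟨fun i j => (hle i j).antisymm (hle j i), fun i j => ?_⟩, fun i j k => ?_⟩
  · refine le_of_forall_gt fun c hc => ?_
    have hi := ((ultraFy_lt_iff M i j c).1 hc).1
    exact (ultraFy_lt_iff M i i c).2 ⟨hi, hi, .refl⟩
  · refine le_of_forall_gt fun c hc => ?_
    obtain ⟨hik, hkj⟩ := max_lt_iff.1 hc
    obtain ⟨hi, _, h₁⟩ := (ultraFy_lt_iff M i k c).1 hik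
    obtain ⟨_, hj, h₂⟩ := (ultraFy_lt_iff M k j c).1 hkj
    exact (ultraFy_lt_iff M i j c).2 ⟨hi, hj, h₁.trans h₂⟩

theorem ultraFy_le {n : ℕ} {M : Fin n → Fin n → ℝ} (hM : IsValid M) (i j : Fin n) :
    ultraFy M i j ≤ M i j := by
  refine le_of_forall_gt fun c hc => (ultraFy_lt_iff M i j c).2
    ⟨(hM.2 i j).trans_lt hc, ?_, .single hc⟩
  exact (hM.2 j i).trans_lt (by rwa [hM.1 j i])

theorem IsUltra.le_ultraFy_add {n : ℕ} {M A : Fin n → Fin n → ℝ} (hM : IsUltra M) {r : ℝ}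
    (h : ∀ i j, M i j ≤ A i j + r) (i j : Fin n) : M i j ≤ ultraFy A i j + r := by
  rw [← sub_le_iff_le_add]
  refine le_of_forall_gt fun c hc => ?_
  obtain ⟨hi, -, hij⟩ := (ultraFy_lt_iff A i j c).1 hc
  clear hc
  induction hij with
  | refl => linarith [h i i]
  | @tail u v _ huv ih =>
    have := max_lt (sub_lt_iff_lt_add.1 ih) (show M u v < c + r by linarith [h u v])
    linarith [hM.2 i v u]

/-- Ultra-fication moves a valid matrix no further from an ultra matrix. -/
theorem IsUltra.abs_sub_ultraFy_le {n : ℕ} {M A : Fin n → Fin n → ℝ} (hM : IsUltra M)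
    (hA : IsValid A) {r : ℝ} (h : ∀ i j, |M i j - A i j| ≤ r) (i j : Fin n) :
    |M i j - ultraFy A i j| ≤ r := by
  rw [abs_sub_le_iff]
  constructor
  · have hle (i j : Fin n) : M i j ≤ A i j + r := by
      linarith [(abs_sub_le_iff.1 (h i j)).1]
    linarith [hM.le_ultraFy_add hle i j]
  · linarith [(abs_sub_le_iff.1 (h i j)).2, ultraFy_le hA i j]

theorem supDist_le {n : ℕ} (hn : 1 ≤ n) {A B : Fin n → Fin n → ℝ} {r : ℝ}
    (h : ∀ i j, |A i j - B i j| ≤ r) : supDist A B ≤ r := by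
  refine csSup_le ⟨_, ⟨0, hn⟩, ⟨0, hn⟩, rfl⟩ ?_
  rintro x ⟨i, j, rfl⟩
  exact h i j

theorem supDist_triangle {n : ℕ} (hn : 1 ≤ n) (A B C : Fin n → Fin n → ℝ) :
    supDist A C ≤ supDist A B + supDist B C :=
  supDist_le hn fun i j => (abs_sub_le _ (B i j) _).trans
    (add_le_add (abs_sub_le_supDist A B i j) (abs_sub_le_supDist B C i j))

/-- The space of ultra matrices with the sup distance admits midpoints:
`N = Ũ((M + M')/2)` is an ultra matrix at distance `‖M - M'‖_∞ / 2` from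
both `M` and `M'`. -/
theorem ultraMatrices_midpoint {n : ℕ} (hn : 1 ≤ n)
    (M M' : Fin n → Fin n → ℝ) (hM : IsUltra M) (hM' : IsUltra M')
    (N : Fin n → Fin n → ℝ)
    (hN : N = ultraFy (fun i j => (M i j + M' i j) / 2)) :
    IsUltra N ∧
    supDist M N = supDist M M' / 2 ∧
    supDist N M' = supDist M M' / 2 := by
  subst hN
  have hA : IsValid fun i j => (M i j + M' i j) / 2 :=
    ⟨fun i j => by simp only [hM.1.1 i j, hM'.1.1 i j],
      fun i j => by linarith [hM.1.2 i j, hM'.1.2 i j]⟩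
  have hd (i j : Fin n) := abs_sub_le_iff.1 (abs_sub_le_supDist M M' i j)
  have h₁ : supDist M (ultraFy fun i j => (M i j + M' i j) / 2) ≤ supDist M M' / 2 :=
    supDist_le hn <| hM.abs_sub_ultraFy_le hA fun i j => by
      rw [abs_sub_le_iff]
      constructor <;> linarith [hd i j]
  have h₂ : supDist (ultraFy fun i j => (M i j + M' i j) / 2) M' ≤ supDist M M' / 2 :=
    supDist_le hn fun i j => by
      rw [abs_sub_comm]
      refine hM'.abs_sub_ultraFy_le hA (fun i j => ?_) i j
      rw [abs_sub_le_iff]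
      constructor <;> linarith [hd i j]
  have h₃ := supDist_triangle hn M (ultraFy fun i j => (M i j + M' i j) / 2) M'
  exact ⟨isUltra_ultraFy hA.1, by linarith, by linarith⟩
end
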